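/- arXiv:math/0406523 — 2 statements merged into one kernel-verified Lean document; each statement's English description precedes it below -/
import Mathlib

section
/- Suppose F satisfies the second-order tail conditions with α_R < 2 and α_L = 2. Then there is a strictly positive finite constant C_R, depending only on c_R and α_R, such that σ²(m/n, k/n) / [ C_R (k/n)^{1−2/α_R} + ∫_{m/n}^{1/2} [F⁻(s)]² ds ] → 1 as n → ∞. -/
open Filter Set Topology MeasureTheory

/-- The generalized inverse (quantile function) of a distribution function `F`:
`F⁻(u) = inf {x : F x ≥ u}`. -/
noncomputable def quantile (F : ℝ → ℝ) (u : ℝ) : ℝ := sInf {x : ℝ | u ≤ F x}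

/-- The Lebesgue–Stieltjes measure associated to a nondecreasing function `g`
(junk value `0` if `g` is not monotone). -/
noncomputable def lsMeasure (g : ℝ → ℝ) : Measure ℝ :=
  open scoped Classical in
  if hg : Monotone g then hg.stieltjesFunction.measure else 0

/-- The quantile function of `F` clamped to `[s, 1 - t]`: a nondecreasing function of `u`
that agrees with `F⁻` on `[s, 1 - t]`. -/
noncomputable def clampedQuantile (F : ℝ → ℝ) (s t u : ℝ) : ℝ :=
  quantile F (max s (min u (1 - t)))

/-- `σ²(s,t) = ∫_s^{1-t} ∫_s^{1-t} (u ∧ v - u v) dF⁻(u) dF⁻(v)`, the double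
Lebesgue–Stieltjes integral over `(s, 1-t]` with respect to the nondecreasing
function `F⁻`. -/
noncomputable def sigmaSq (F : ℝ → ℝ) (s t : ℝ) : ℝ :=
  ∫ u in Ioc s (1 - t), ∫ v in Ioc s (1 - t), (min u v - u * v)
    ∂(lsMeasure (clampedQuantile F s t)) ∂(lsMeasure (clampedQuantile F s t))

/-- Second-order right-tail condition: as `x → ∞`,
`1 - F x = c * x^(-α) * (1 + b * x^(-β) + o (x^(-β)))`. -/
def RightTailSecondOrder (F : ℝ → ℝ) (c α b β : ℝ) : Prop :=
  Tendsto (fun x : ℝ => ((1 - F x) / (c * x ^ (-α)) - 1) * x ^ β) atTop (nhds b)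

/-- Second-order left-tail condition: as `x → ∞`,
`F (-x) = c * x^(-α) * (1 + b * x^(-β) + o (x^(-β)))`. -/
def LeftTailSecondOrder (F : ℝ → ℝ) (c α b β : ℝ) : Prop :=
  Tendsto (fun x : ℝ => (F (-x) / (c * x ^ (-α)) - 1) * x ^ β) atTop (nhds b)

/-- `F` is a distribution function: nondecreasing, right-continuous, with limits
`0` at `-∞` and `1` at `+∞`. -/
structure IsDistributionFunction (F : ℝ → ℝ) : Prop where
  mono : Monotone F
  right_continuous : ∀ x : ℝ, ContinuousWithinAt F (Ici x) x
  tendsto_atTop : Tendsto F atTop (nhds 1)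
  tendsto_atBot : Tendsto F atBot (nhds 0)


/-- A second-order tail expansion implies the first-order one. -/
lemma tendsto_mul_rpow_of_secondOrder {G : ℝ → ℝ} {c α b β : ℝ} (hc : 0 < c) (hβ : 0 < β)
    (h : Tendsto (fun x : ℝ => (G x / (c * x ^ (-α)) - 1) * x ^ β) atTop (𝓝 b)) :
    Tendsto (fun x : ℝ => G x * x ^ α) atTop (𝓝 c) := by
  have h1 := h.mul (tendsto_rpow_neg_atTop hβ)
  have h2 := (h1.add_const 1).mul_const c
  simp only [mul_zero, zero_add, one_mul] at h2
  refine h2.congr' ?_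
  filter_upwards [eventually_gt_atTop 0] with x hx
  have e1 : x ^ β ≠ 0 := (Real.rpow_pos_of_pos hx _).ne'
  have e2 : x ^ α ≠ 0 := (Real.rpow_pos_of_pos hx _).ne'
  rw [Real.rpow_neg hx.le, Real.rpow_neg hx.le]
  field_simp
  ring

lemma exists_lt_of_tendsto_mul_rpow {G : ℝ → ℝ} {c α : ℝ} (hα : 0 < α)
    (h : Tendsto (fun x : ℝ => G x * x ^ α) atTop (𝓝 c)) :
    ∃ D : ℝ, 0 < D ∧ ∀ u, 0 < u → u < 1 → G (D * u ^ (-(1 / α))) < u := by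
  have h1 : ∀ᶠ x in atTop, G x * x ^ α < c + 1 := h.eventually_lt_const (by linarith)
  obtain ⟨X, hX⟩ := eventually_atTop.1 h1
  obtain ⟨D, hD0, hDX, hDc⟩ := ((eventually_gt_atTop (0 : ℝ)).and ((eventually_ge_atTop X).and
    ((tendsto_rpow_atTop hα).eventually_ge_atTop (c + 1)))).exists
  refine ⟨D, hD0, fun u hu hu1 => ?_⟩
  have hone : 1 ≤ u ^ (-(1 / α)) :=
    Real.one_le_rpow_of_pos_of_le_one_of_nonpos hu hu1.le (by simp [hα.le])
  have h2 := hX (D * u ^ (-(1 / α))) (hDX.trans (le_mul_of_one_le_right hD0.le hone))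
  rw [Real.mul_rpow hD0.le (by positivity), ← Real.rpow_mul hu.le,
    show -(1 / α) * α = -1 by field_simp, Real.rpow_neg_one] at h2
  have hDα : 0 < D ^ α := Real.rpow_pos_of_pos hD0 _
  have h3 := h2.trans_le hDc
  rw [mul_comm (D ^ α), ← mul_assoc, ← div_eq_mul_inv] at h3
  have h4 : G (D * u ^ (-(1 / α))) / u < 1 := by
    by_contra hcon
    push Not at hcon
    nlinarith
  exact (div_lt_one hu).1 h4

namespace IsDistributionFunction

variable {F : ℝ → ℝ}

lemma quantile_le_iff (hF : IsDistributionFunction F) {u x : ℝ} (hu : 0 < u) (hu1 : u < 1) :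
    quantile F u ≤ x ↔ u ≤ F x := by
  have hne : {x : ℝ | u ≤ F x}.Nonempty :=
    (hF.tendsto_atTop.eventually_const_le hu1).exists
  have hbdd : BddBelow {x : ℝ | u ≤ F x} := by
    obtain ⟨y, hy⟩ := (hF.tendsto_atBot.eventually_lt_const hu).exists
    refine ⟨y, fun z hz => ?_⟩
    by_contra hcon
    exact absurd (hF.mono (not_le.1 hcon).le) (not_le.2 (hy.trans_le hz))
  refine ⟨fun h => ?_, fun h => csInf_le hbdd h⟩
  have hlim : Tendsto F (𝓝[>] x) (𝓝 (F x)) :=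
    (hF.right_continuous x).mono_left (nhdsWithin_mono _ Ioi_subset_Ici_self)
  refine ge_of_tendsto hlim ?_
  filter_upwards [self_mem_nhdsWithin] with y hy
  obtain ⟨z, hz, hzy⟩ := (csInf_lt_iff hbdd hne).1 (h.trans_lt hy)
  exact le_trans hz (hF.mono hzy.le)

lemma lt_quantile_iff (hF : IsDistributionFunction F) {u x : ℝ} (hu : 0 < u) (hu1 : u < 1) :
    x < quantile F u ↔ F x < u := by
  rw [← not_le, hF.quantile_le_iff hu hu1, not_le]

lemma quantile_monotoneOn (hF : IsDistributionFunction F) :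
    MonotoneOn (quantile F) (Ioo 0 1) := by
  intro u hu v hv huv
  rw [hF.quantile_le_iff hu.1 hu.2]
  exact huv.trans ((hF.quantile_le_iff hv.1 hv.2).1 le_rfl)

lemma monotone_clampedQuantile (hF : IsDistributionFunction F) {s t : ℝ} (hs : 0 < s)
    (ht : 0 < t) (hst : s < 1 - t) : Monotone (clampedQuantile F s t) := by
  have key : ∀ u, max s (min u (1 - t)) ∈ Ioo (0 : ℝ) 1 := fun u =>
    ⟨hs.trans_le (le_max_left _ _),
      max_lt (by linarith) ((min_le_right _ _).trans_lt (by linarith))⟩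
  intro u v huv
  refine hF.quantile_monotoneOn (key u) (key v) ?_
  gcongr

lemma exists_abs_quantile_le (hF : IsDistributionFunction F) {cL αL cR αR : ℝ} (hαL : 0 < αL)
    (hαR : 0 < αR) (hL : Tendsto (fun x : ℝ => F (-x) * x ^ αL) atTop (𝓝 cL))
    (hR : Tendsto (fun x : ℝ => (1 - F x) * x ^ αR) atTop (𝓝 cR)) :
    ∃ D : ℝ, 0 < D ∧ ∀ u ∈ Ioo (0 : ℝ) 1,
      |quantile F u| ≤ D * u ^ (-(1 / αL)) + D * (1 - u) ^ (-(1 / αR)) := by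
  obtain ⟨D₁, hD₁, h₁⟩ := exists_lt_of_tendsto_mul_rpow hαL hL
  obtain ⟨D₂, hD₂, h₂⟩ := exists_lt_of_tendsto_mul_rpow hαR hR
  refine ⟨max D₁ D₂, lt_max_of_lt_left hD₁, fun u hu => ?_⟩
  have hp : 0 < u ^ (-(1 / αL)) := Real.rpow_pos_of_pos hu.1 _
  have hq : 0 < (1 - u) ^ (-(1 / αR)) := Real.rpow_pos_of_pos (by linarith [hu.2]) _
  have l₁ := (hF.lt_quantile_iff hu.1 hu.2).2 (h₁ u hu.1 hu.2)
  have l₂ := (hF.quantile_le_iff (x := D₂ * (1 - u) ^ (-(1 / αR))) hu.1 hu.2).2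
    (by linarith [h₂ (1 - u) (by linarith [hu.2]) (by linarith [hu.1])])
  have m₁ := mul_le_mul_of_nonneg_right (le_max_left D₁ D₂) hp.le
  have m₂ := mul_le_mul_of_nonneg_right (le_max_right D₁ D₂) hq.le
  have n₁ := mul_pos hD₁ hp
  have n₂ := mul_pos hD₂ hq
  rw [abs_le]
  constructor <;> linarith

lemma tendsto_quantile_one_sub_mul_rpow (hF : IsDistributionFunction F) {c α : ℝ} (hc : 0 < c)
    (hα : 0 < α) (hR : Tendsto (fun x : ℝ => (1 - F x) * x ^ α) atTop (𝓝 c)) :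
    Tendsto (fun t : ℝ => quantile F (1 - t) * t ^ (1 / α)) (𝓝[>] 0) (𝓝 (c ^ (1 / α))) := by
  have hinf : ∀ y : ℝ, 0 < y →
      Tendsto (fun t : ℝ => y * t ^ (-(1 / α))) (𝓝[>] 0) atTop := fun y hy =>
    (tendsto_rpow_neg_nhdsGT_zero (by simpa using hα)).const_mul_atTop hy
  have hsmall : ∀ᶠ t : ℝ in 𝓝[>] 0, t ∈ Ioo (0 : ℝ) 1 := Ioo_mem_nhdsGT one_pos
  have hcα : 0 < c ^ (1 / α) := Real.rpow_pos_of_pos hc _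
  have hcc : (c ^ (1 / α)) ^ α = c := by
    rw [← Real.rpow_mul hc.le, one_div_mul_cancel hα.ne', Real.rpow_one]
  have hpow : ∀ y t : ℝ, 0 < y → 0 < t → (y * t ^ (-(1 / α))) ^ α = y ^ α / t := by
    intro y t hy ht
    rw [Real.mul_rpow hy.le (by positivity), ← Real.rpow_mul ht.le,
      show -(1 / α) * α = -1 by field_simp, Real.rpow_neg_one, div_eq_mul_inv]
  have hcancel : ∀ t : ℝ, 0 < t → ∀ y, y * t ^ (-(1 / α)) * t ^ (1 / α) = y := by
    intro t ht y
    rw [mul_assoc, ← Real.rpow_add ht]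
    simp
  have hposR : ∀ t : ℝ, 0 < t → 0 < t ^ (1 / α) := fun t ht => Real.rpow_pos_of_pos ht _
  rw [tendsto_order]
  constructor
  · intro z hz
    obtain ⟨y, hy, hyc⟩ := exists_between (max_lt hz hcα)
    have hy0 : 0 < y := (le_max_right _ _).trans_lt hy
    have hyα : y ^ α < c := by
      rw [← hcc]
      exact Real.rpow_lt_rpow hy0.le hyc hα
    filter_upwards [hsmall, (hinf y hy0).eventually (hR.eventually_const_lt hyα)] with t ht h1
    rw [hpow y t hy0 ht.1] at h1
    have hyp : 0 < y ^ α := Real.rpow_pos_of_pos hy0 _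
    have h2 : t < 1 - F (y * t ^ (-(1 / α))) := by
      rw [mul_div_assoc', lt_div_iff₀ ht.1] at h1
      nlinarith
    have h3 := (hF.lt_quantile_iff (u := 1 - t) (x := y * t ^ (-(1 / α)))
      (by linarith [ht.2]) (by linarith [ht.1])).2 (by linarith)
    have h4 := mul_lt_mul_of_pos_right h3 (hposR t ht.1)
    rw [hcancel t ht.1] at h4
    exact ((le_max_left _ _).trans_lt hy).trans h4
  · intro z hz
    obtain ⟨y, hy, hyz⟩ := exists_between hz
    have hy0 : 0 < y := hcα.trans hy
    have hyα : c < y ^ α := by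
      rw [← hcc]
      exact Real.rpow_lt_rpow hcα.le hy hα
    filter_upwards [hsmall, (hinf y hy0).eventually (hR.eventually_lt_const hyα)] with t ht h1
    rw [hpow y t hy0 ht.1] at h1
    have hyp : 0 < y ^ α := Real.rpow_pos_of_pos hy0 _
    have h2 : 1 - F (y * t ^ (-(1 / α))) < t := by
      rw [mul_div_assoc', div_lt_iff₀ ht.1] at h1
      nlinarith
    have h3 := (hF.quantile_le_iff (u := 1 - t) (x := y * t ^ (-(1 / α)))
      (by linarith [ht.2]) (by linarith [ht.1])).2 (by linarith)
    have h4 := mul_le_mul_of_nonneg_right h3 (hposR t ht.1).le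
    rw [hcancel t ht.1] at h4
    exact h4.trans_lt hyz

end IsDistributionFunction

/-- The covariance kernel of the indicators `𝟙{U ≤ u}`, `U` uniform on `(0, 1]`, integrated
twice against `ν`, is the variance of `ν [U, ∞)`. -/
lemma integral_integral_min_sub_mul (ν : Measure ℝ) [IsFiniteMeasure ν]
    (hν : ∀ᵐ u ∂ν, u ∈ Ioc (0 : ℝ) 1) :
    ∫ u, ∫ v, (min u v - u * v) ∂ν ∂ν =
      (∫ w in (0 : ℝ)..1, ν.real (Ici w) ^ 2) - (∫ w in (0 : ℝ)..1, ν.real (Ici w)) ^ 2 := by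
  set φ : ℝ → ℝ → ℝ := fun u w => (Ici w).indicator 1 u with hφ
  set lam : Measure ℝ := volume.restrict (Ioc (0 : ℝ) 1) with hlam
  have hmeas : Measurable (fun p : ℝ × ℝ => φ p.1 p.2) := by
    have : (fun p : ℝ × ℝ => φ p.1 p.2) = {p : ℝ × ℝ | p.2 ≤ p.1}.indicator 1 := by
      ext p
      simp [hφ, indicator]
    rw [this]
    exact measurable_one.indicator (measurableSet_le measurable_snd measurable_fst)
  have hb : ∀ u w, ‖φ u w‖ ≤ 1 := by
    intro u w
    simp only [hφ, indicator]
    split_ifs <;> simp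
  have hh : ∀ w, ∫ u, φ u w ∂ν = ν.real (Ici w) := fun w =>
    integral_indicator_one measurableSet_Ici
  have hanti : Antitone fun w => ν.real (Ici w) := fun x y hxy =>
    measureReal_mono (Ici_subset_Ici.2 hxy)
  have hu : ∀ u ∈ Ioc (0 : ℝ) 1, ∫ w, φ u w ∂lam = u := by
    intro u hu
    have : (fun w => φ u w) = (Iic u).indicator 1 := by
      ext w
      simp [hφ, indicator]
    rw [this, integral_indicator_one measurableSet_Iic, hlam, measureReal_restrict_apply
      measurableSet_Iic]
    have : Iic u ∩ Ioc 0 1 = Ioc 0 u := by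
      ext w
      simp only [mem_inter_iff, mem_Iic, mem_Ioc]
      exact ⟨fun h => ⟨h.2.1, h.1⟩, fun h => ⟨h.2, h.1, h.2.trans hu.2⟩⟩
    rw [this]
    simp [hu.1.le]
  have hmin : ∀ u v w, φ (min u v) w = φ u w * φ v w := by
    intro u v w
    simp only [hφ, indicator, mem_Ici, le_min_iff, Pi.one_apply]
    split_ifs <;> simp_all
  have hid : ∫ u, u ∂ν = ∫ w, ν.real (Ici w) ∂lam := by
    calc ∫ u, u ∂ν = ∫ u, ∫ w, φ u w ∂lam ∂ν :=
          integral_congr_ae (hν.mono fun u h => (hu u h).symm)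
      _ = ∫ w, ∫ u, φ u w ∂ν ∂lam := integral_integral_swap
          (Integrable.of_bound hmeas.aestronglyMeasurable 1 (ae_of_all _ fun p => hb _ _))
      _ = _ := by simp only [hh]
  have hid_int : Integrable (fun u : ℝ => u) ν :=
    Integrable.of_bound measurable_id.aestronglyMeasurable 1 (hν.mono fun u h => by
      rw [Real.norm_eq_abs, abs_of_pos h.1]; exact h.2)
  have hmin_int : ∀ u ∈ Ioc (0 : ℝ) 1, Integrable (fun v : ℝ => min u v) ν := fun u h =>
    Integrable.of_bound (measurable_const.min measurable_id).aestronglyMeasurable 1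
      (hν.mono fun v hv => by
        rw [Real.norm_eq_abs, abs_of_pos (lt_min h.1 hv.1)]; exact (min_le_left _ _).trans h.2)
  have hinner : ∀ u ∈ Ioc (0 : ℝ) 1,
      ∫ v, min u v ∂ν = ∫ w, φ u w * ν.real (Ici w) ∂lam := by
    intro u h
    calc ∫ v, min u v ∂ν = ∫ v, ∫ w, φ u w * φ v w ∂lam ∂ν := by
          refine integral_congr_ae (hν.mono fun v hv => ?_)
          simp only [← hmin]
          exact (hu _ ⟨lt_min h.1 hv.1, (min_le_left _ _).trans h.2⟩).symm
      _ = ∫ w, ∫ v, φ u w * φ v w ∂ν ∂lam := by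
          refine integral_integral_swap (Integrable.of_bound
            (Measurable.aestronglyMeasurable ?_) 1 (ae_of_all _ fun p => ?_))
          · exact (hmeas.comp (measurable_const.prodMk measurable_snd)).mul hmeas
          · simp only [Function.uncurry, norm_mul]
            exact mul_le_one₀ (hb _ _) (norm_nonneg _) (hb _ _)
      _ = _ := by simp only [integral_const_mul, hh]
  have hprod : Integrable (Function.uncurry fun u w => φ u w * ν.real (Ici w)) (ν.prod lam) := by
    refine Integrable.of_bound (Measurable.aestronglyMeasurable ?_) (ν.real univ)
      (ae_of_all _ fun p => ?_)
    · exact hmeas.mul (hanti.measurable.comp measurable_snd)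
    · simp only [Function.uncurry, norm_mul]
      refine (mul_le_of_le_one_left (norm_nonneg _) (hb _ _)).trans ?_
      rw [Real.norm_eq_abs, abs_of_nonneg measureReal_nonneg]
      exact measureReal_mono (subset_univ _)
  have hinner_int : Integrable (fun u => ∫ w, φ u w * ν.real (Ici w) ∂lam) ν :=
    hprod.integral_prod_left
  rw [intervalIntegral.integral_of_le zero_le_one, intervalIntegral.integral_of_le zero_le_one,
    ← hlam]
  calc ∫ u, ∫ v, (min u v - u * v) ∂ν ∂ν
      = ∫ u, ((∫ w, φ u w * ν.real (Ici w) ∂lam) - u * ∫ v, v ∂ν) ∂ν := by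
        refine integral_congr_ae (hν.mono fun u h => ?_)
        simp only
        rw [integral_sub (hmin_int u h) (hid_int.const_mul u), hinner u h, integral_const_mul]
    _ = (∫ u, ∫ w, φ u w * ν.real (Ici w) ∂lam ∂ν) - (∫ u, u ∂ν) * ∫ v, v ∂ν := by
        rw [integral_sub hinner_int (hid_int.mul_const _), integral_mul_const]
    _ = _ := by
        rw [integral_integral_swap hprod, hid, sq (∫ w, ν.real (Ici w) ∂lam)]
        simp only [integral_mul_const, hh, sq]

/-- The winsorized-variance formula: `σ²(s, t)` is the variance of the quantile function clamped
to `(s, 1 - t]`. -/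
lemma IsDistributionFunction.exists_sigmaSq_eq {F : ℝ → ℝ} (hF : IsDistributionFunction F)
    {s t : ℝ} (hs : 0 < s) (ht : 0 < t) (hst : s < 1 - t) :
    ∃ q : ℝ, quantile F s ≤ q ∧ (∀ x ∈ Ioc s (1 - t), q ≤ quantile F x) ∧
      sigmaSq F s t =
        (s * q ^ 2 + (∫ u in s..(1 - t), quantile F u ^ 2) + t * quantile F (1 - t) ^ 2) -
          (s * q + (∫ u in s..(1 - t), quantile F u) + t * quantile F (1 - t)) ^ 2 := by
  have hg := hF.monotone_clampedQuantile hs ht hst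
  set g := clampedQuantile F s t with hgdef
  set S := hg.stieltjesFunction with hS
  set ν : Measure ℝ := S.measure.restrict (Ioc s (1 - t)) with hν
  have hgeq : ∀ x, s ≤ x → x ≤ 1 - t → g x = quantile F x := by
    intro x h1 h2
    rw [hgdef, clampedQuantile, min_eq_left h2, max_eq_right h1]
  have hgge : ∀ x, 1 - t ≤ x → g x = quantile F (1 - t) := by
    intro x h1
    rw [hgdef, clampedQuantile, min_eq_right h1, max_eq_right hst.le]
  have hSB : S (1 - t) = quantile F (1 - t) := by
    rw [hS, hg.stieltjesFunction_eq]
    refine rightLim_eq_of_tendsto (tendsto_const_nhds.congr' ?_)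
    filter_upwards [self_mem_nhdsWithin] with x hx using (hgge x (le_of_lt hx)).symm
  have hfin : IsFiniteMeasure ν := by
    refine ⟨?_⟩
    rw [hν, Measure.restrict_apply_univ, S.measure_Ioc]
    exact ENNReal.ofReal_lt_top
  have hlow : ∀ w, w ≤ s → ν.real (Ici w) = quantile F (1 - t) - S s := by
    intro w hw
    have hsub : Ioc s (1 - t) ⊆ Ici w := fun x hx => hw.trans hx.1.le
    rw [hν, measureReal_restrict_apply measurableSet_Ici, inter_eq_right.2 hsub,
      measureReal_def, S.measure_Ioc, hSB, ENNReal.toReal_ofReal]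
    rw [← hSB]
    exact sub_nonneg.2 (S.mono hst.le)
  have hmid : ∀ w ∈ Ioc s (1 - t), ContinuousAt g w →
      ν.real (Ici w) = quantile F (1 - t) - quantile F w := by
    intro w hw hc
    have hleft : Function.leftLim S w = quantile F w := by
      have e : (S : ℝ → ℝ) = Function.rightLim g := rfl
      rw [e, leftLim_rightLim (hg.tendsto_leftLim w), ← hgeq w hw.1.le hw.2]
      exact hc.continuousWithinAt.leftLim_eq
    have hset : Ici w ∩ Ioc s (1 - t) = Icc w (1 - t) := by
      ext x
      simp only [mem_inter_iff, mem_Ici, mem_Ioc, mem_Icc]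
      exact ⟨fun h => ⟨h.1, h.2.2⟩, fun h => ⟨h.1, hw.1.trans_le h.1, h.2⟩⟩
    rw [hν, measureReal_restrict_apply measurableSet_Ici, hset, measureReal_def, S.measure_Icc,
      hSB, hleft, ENNReal.toReal_ofReal]
    exact sub_nonneg.2 (hF.quantile_monotoneOn ⟨hs.trans hw.1, hw.2.trans_lt (by linarith)⟩
      ⟨hs.trans hst, by linarith⟩ hw.2)
  have hhigh : ∀ w, 1 - t < w → ν.real (Ici w) = 0 := by
    intro w hw
    have hset : Ici w ∩ Ioc s (1 - t) = ∅ := by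
      ext x
      simp only [mem_inter_iff, mem_Ici, mem_Ioc, mem_empty_iff_false, iff_false]
      rintro ⟨h1, -, h2⟩
      linarith
    rw [hν, measureReal_restrict_apply measurableSet_Ici, hset]
    simp
  have hcont : ∀ᵐ w : ℝ, ContinuousAt g w := by
    filter_upwards [hg.countable_not_continuousAt.ae_notMem volume] with w hw
    simpa using hw
  have hanti : Antitone fun w => ν.real (Ici w) := fun x y hxy =>
    measureReal_mono (Ici_subset_Ici.2 hxy)
  set B := quantile F (1 - t) with hB
  have hmono : Monotone fun w => B - ν.real (Ici w) := fun x y hxy =>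
    sub_le_sub_left (hanti hxy) B
  have hint1 : ∀ a b, IntervalIntegrable (fun w => B - ν.real (Ici w)) volume a b :=
    fun a b => hmono.intervalIntegrable
  have hint2 : ∀ a b, IntervalIntegrable (fun w => (B - ν.real (Ici w)) ^ 2) volume a b := by
    intro a b
    have : Antitone fun w => ν.real (Ici w) ^ 2 := fun x y hxy =>
      pow_le_pow_left₀ measureReal_nonneg (hanti hxy) 2
    have h2 := ((intervalIntegrable_const (c := B ^ 2) (μ := volume) (a := a) (b := b)).sub
      ((hanti.intervalIntegrable (μ := volume) (a := a) (b := b)).const_mul (2 * B))).add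
        (this.intervalIntegrable (μ := volume) (a := a) (b := b))
    refine h2.congr (fun w _ => ?_)
    ring
  have hsplit : ∀ φ : ℝ → ℝ, (∀ a b, IntervalIntegrable (fun w => φ (B - ν.real (Ici w)))
      volume a b) → ∫ w in (0 : ℝ)..1, φ (B - ν.real (Ici w)) =
        s * φ (S s) + (∫ u in s..(1 - t), φ (quantile F u)) + t * φ B := by
    intro φ hφ
    rw [← intervalIntegral.integral_add_adjacent_intervals (hφ 0 s) (hφ s 1),
      ← intervalIntegral.integral_add_adjacent_intervals (hφ s (1 - t)) (hφ (1 - t) 1),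
      ← add_assoc]
    congr 1
    · congr 1
      · have : ∫ w in (0 : ℝ)..s, φ (B - ν.real (Ici w)) = ∫ w in (0 : ℝ)..s, φ (S s) := by
          refine intervalIntegral.integral_congr fun w hw => ?_
          rw [uIcc_of_le hs.le] at hw
          simp only [hlow w hw.2, sub_sub_cancel]
        rw [this]
        simp
      · refine intervalIntegral.integral_congr_ae ?_
        filter_upwards [hcont] with w hw hmem
        rw [uIoc_of_le hst.le] at hmem
        rw [hmid w hmem hw, sub_sub_cancel]
    · have : ∫ w in (1 - t)..1, φ (B - ν.real (Ici w)) = ∫ w in (1 - t)..1, φ B := by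
        refine intervalIntegral.integral_congr_ae (ae_of_all _ fun w hw => ?_)
        rw [uIoc_of_le (by linarith)] at hw
        simp only [hhigh w hw.1, sub_zero]
      rw [this]
      simp
  refine ⟨S s, ?_, ?_, ?_⟩
  · rw [← hgeq s le_rfl hst.le, hS, hg.stieltjesFunction_eq]
    exact hg.le_rightLim le_rfl
  · intro x hx
    rw [← hgeq x hx.1.le hx.2, hS, hg.stieltjesFunction_eq]
    exact hg.rightLim_le hx.1
  have hsig : sigmaSq F s t = ∫ u, ∫ v, (min u v - u * v) ∂ν ∂ν := by
    rw [sigmaSq, lsMeasure, dif_pos hg]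
  have hsupp : ∀ᵐ u ∂ν, u ∈ Ioc (0 : ℝ) 1 := by
    filter_upwards [ae_restrict_mem (μ := S.measure) (measurableSet_Ioc (a := s) (b := 1 - t))]
      with u hu
    exact ⟨hs.trans hu.1, hu.2.trans (by linarith)⟩
  rw [hsig, integral_integral_min_sub_mul ν hsupp, ← hsplit (fun x => x ^ 2) hint2,
    ← hsplit (fun x => x) hint1]
  have e1 : ∫ w in (0 : ℝ)..1, ν.real (Ici w) =
      B - ∫ w in (0 : ℝ)..1, (B - ν.real (Ici w)) := by
    rw [intervalIntegral.integral_sub intervalIntegrable_const hanti.intervalIntegrable]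
    simp
  have e2 : ∫ w in (0 : ℝ)..1, ν.real (Ici w) ^ 2 = B ^ 2 -
      2 * B * (∫ w in (0 : ℝ)..1, (B - ν.real (Ici w))) +
        ∫ w in (0 : ℝ)..1, (B - ν.real (Ici w)) ^ 2 := by
    rw [← intervalIntegral.integral_const_mul]
    have e3 : B ^ 2 = ∫ w in (0 : ℝ)..1, B ^ 2 := by simp
    rw [e3, ← intervalIntegral.integral_sub intervalIntegrable_const
      ((hint1 0 1).const_mul _), ← intervalIntegral.integral_add
      (intervalIntegrable_const.sub ((hint1 0 1).const_mul _)) (hint2 0 1)]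
    refine intervalIntegral.integral_congr fun w _ => ?_
    ring
  rw [e1, e2]
  ring

/-- Karamata-type asymptotics for the truncated second moment of a monotone function with a
power singularity at `0`. -/
lemma tendsto_rpow_mul_integral_sq {r : ℝ → ℝ} {a A M : ℝ} (ha : 1 < 2 * a)
    (hr : AntitoneOn r (Ioo 0 1))
    (hlim : Tendsto (fun u : ℝ => r u * u ^ a) (𝓝[>] 0) (𝓝 A))
    (hM : ∀ u, 0 < u → u ≤ 1 / 2 → |r u| ≤ M * u ^ (-a)) :
    Tendsto (fun t : ℝ => t ^ (2 * a - 1) * ∫ u in t..(1 / 2), r u ^ 2) (𝓝[>] 0)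
      (𝓝 (A ^ 2 / (2 * a - 1))) := by
  have hsmall : ∀ᶠ t : ℝ in 𝓝[>] 0, t ∈ Ioo (0 : ℝ) (1 / 2) := Ioo_mem_nhdsGT (by norm_num)
  have hsq : ∀ v : ℝ, 0 < v → v ^ (-(2 * a)) = (v ^ (-a)) ^ 2 := by
    intro v hv
    rw [← Real.rpow_natCast, ← Real.rpow_mul hv.le]
    congr 1
    push_cast
    ring
  have hI : ∫ v in Ioi (1 : ℝ), A ^ 2 * v ^ (-(2 * a)) = A ^ 2 / (2 * a - 1) := by
    rw [integral_const_mul, integral_Ioi_rpow_of_lt (by linarith) one_pos, Real.one_rpow,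
      show -(2 * a) + 1 = -(2 * a - 1) by ring, neg_div_neg_eq, mul_one_div]
  have key : Tendsto (fun t : ℝ => ∫ v in Ioi (1 : ℝ),
      (Ioc 1 (1 / (2 * t))).indicator (fun v => (t ^ a * r (t * v)) ^ 2) v) (𝓝[>] 0)
      (𝓝 (∫ v in Ioi (1 : ℝ), A ^ 2 * v ^ (-(2 * a)))) := by
    refine tendsto_integral_filter_of_dominated_convergence
      (fun v => M ^ 2 * v ^ (-(2 * a))) ?_ ?_ ?_ ?_
    · filter_upwards [hsmall] with t ht
      refine AEStronglyMeasurable.mono_measure ?_ Measure.restrict_le_self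
      rw [aestronglyMeasurable_indicator_iff measurableSet_Ioc]
      refine AEMeasurable.aestronglyMeasurable (((AEMeasurable.const_mul
        (aemeasurable_restrict_of_antitoneOn measurableSet_Ioc ?_) _).pow_const 2))
      have hin : ∀ v ∈ Ioc 1 (1 / (2 * t)), t * v ∈ Ioo (0 : ℝ) 1 := by
        intro v hv
        have h2 := (le_div_iff₀ (by linarith [ht.1] : 0 < 2 * t)).1 hv.2
        exact ⟨mul_pos ht.1 (by linarith [hv.1]), by linarith⟩
      intro v hv w hw hvw
      exact hr (hin v hv) (hin w hw) (mul_le_mul_of_nonneg_left hvw ht.1.le)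
    · filter_upwards [hsmall] with t ht
      filter_upwards [ae_restrict_mem measurableSet_Ioi] with v hv
      have hv0 : (0 : ℝ) < v := one_pos.trans hv
      have hta : 0 < t ^ a := Real.rpow_pos_of_pos ht.1 _
      have hva : 0 < v ^ (-a) := Real.rpow_pos_of_pos hv0 _
      rw [hsq v hv0]
      by_cases hmem : v ∈ Ioc 1 (1 / (2 * t))
      · rw [indicator_of_mem hmem, norm_pow, ← mul_pow]
        refine pow_le_pow_left₀ (norm_nonneg _) ?_ 2
        rw [Real.norm_eq_abs, abs_mul, abs_of_pos hta]
        have h2 := (le_div_iff₀ (by linarith [ht.1] : 0 < 2 * t)).1 hmem.2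
        have h3 := hM (t * v) (mul_pos ht.1 hv0) (by linarith)
        calc t ^ a * |r (t * v)| ≤ t ^ a * (M * (t * v) ^ (-a)) := by gcongr
          _ = M * v ^ (-a) := by
            rw [Real.mul_rpow ht.1.le hv0.le, Real.rpow_neg ht.1.le]
            field_simp
      · rw [indicator_of_notMem hmem, norm_zero]
        positivity
    · exact (integrableOn_Ioi_rpow_of_lt (by linarith) one_pos).const_mul _
    · filter_upwards [ae_restrict_mem measurableSet_Ioi] with v hv
      have hv0 : (0 : ℝ) < v := one_pos.trans hv
      have htv : Tendsto (fun t : ℝ => t * v) (𝓝[>] 0) (𝓝[>] 0) := by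
        refine tendsto_nhdsWithin_iff.2 ⟨?_, ?_⟩
        · have : Tendsto (fun t : ℝ => t * v) (𝓝 0) (𝓝 (0 * v)) :=
            tendsto_id.mul_const v
          rw [zero_mul] at this
          exact this.mono_left nhdsWithin_le_nhds
        · filter_upwards [self_mem_nhdsWithin] with t ht using mul_pos ht hv0
      have h1 := ((hlim.comp htv).mul_const (v ^ (-a))).pow 2
      rw [mul_pow, ← hsq v hv0] at h1
      refine h1.congr' ?_
      filter_upwards [Ioo_mem_nhdsGT (show (0 : ℝ) < 1 / (2 * v) by positivity)] with t ht
      have h2 := (lt_div_iff₀ (by linarith : 0 < 2 * v)).1 ht.2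
      have hmem : v ∈ Ioc 1 (1 / (2 * t)) :=
        ⟨hv, (le_div_iff₀ (by linarith [ht.1] : 0 < 2 * t)).2 (by linarith)⟩
      rw [indicator_of_mem hmem, Function.comp_apply, Real.mul_rpow ht.1.le hv0.le,
        Real.rpow_neg hv0.le]
      have : v ^ a ≠ 0 := (Real.rpow_pos_of_pos hv0 _).ne'
      field_simp
  rw [hI] at key
  refine key.congr' ?_
  filter_upwards [hsmall] with t ht
  have ht0 : t ≠ 0 := ht.1.ne'
  have hN : (1 : ℝ) ≤ 1 / (2 * t) := by
    rw [le_div_iff₀ (by linarith [ht.1])]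
    linarith [ht.2]
  rw [setIntegral_indicator measurableSet_Ioc, inter_eq_right.2 Ioc_subset_Ioi_self,
    ← intervalIntegral.integral_of_le hN]
  simp only [mul_pow]
  rw [intervalIntegral.integral_const_mul,
    intervalIntegral.integral_comp_mul_left (fun u => r u ^ 2) ht0, mul_one, smul_eq_mul,
    show t * (1 / (2 * t)) = 1 / 2 by field_simp, ← mul_assoc]
  congr 1
  rw [Real.rpow_sub ht.1, Real.rpow_one, ← Real.rpow_natCast, ← Real.rpow_mul ht.1.le,
    div_eq_mul_inv]
  congr 2
  push_cast
  ring

lemma MonotoneOn.intervalIntegrable_sq {f : ℝ → ℝ} {x y : ℝ} (hf : MonotoneOn f (uIcc x y))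
    (hxy : x ≤ y) : IntervalIntegrable (fun u => f u ^ 2) volume x y := by
  have hi := hf.intervalIntegrable (μ := volume)
  rw [intervalIntegrable_iff_integrableOn_Ioc_of_le hxy] at hi ⊢
  have hbound : ∀ᵐ u ∂(volume.restrict (Ioc x y)), ‖f u‖ ≤ |f x| + |f y| := by
    filter_upwards [ae_restrict_mem measurableSet_Ioc] with u hu
    have h1 := hf left_mem_uIcc (uIcc_of_le hxy ▸ ⟨hu.1.le, hu.2⟩) hu.1.le
    have h2 := hf (uIcc_of_le hxy ▸ ⟨hu.1.le, hu.2⟩) right_mem_uIcc hu.2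
    rw [Real.norm_eq_abs, abs_le]
    constructor
    · linarith [neg_abs_le (f x), abs_nonneg (f y)]
    · linarith [le_abs_self (f y), abs_nonneg (f x)]
  have h := hi.bdd_mul hi.aestronglyMeasurable hbound
  simpa only [IntegrableOn, sq] using h

/-- For a left tail of index `2` and an integrable right tail, the lower winsorized mass and the
squared mean contribute only a bounded amount to `σ²(s, t)`. -/
lemma IsDistributionFunction.exists_abs_sigmaSq_sub_le {F : ℝ → ℝ}
    (hF : IsDistributionFunction F) {D a : ℝ} (hD : 0 < D) (ha0 : 0 < a) (ha1 : a < 1)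
    (hQ : ∀ u ∈ Ioo (0 : ℝ) 1,
      |quantile F u| ≤ D * u ^ (-(1 / 2) : ℝ) + D * (1 - u) ^ (-a)) :
    ∃ K : ℝ, ∀ s t : ℝ, 0 < s → s < 1 / 2 → 0 < t → t < 1 / 2 →
      |sigmaSq F s t - ((t * quantile F (1 - t) ^ 2 +
        ∫ u in t..(1 / 2), quantile F (1 - u) ^ 2) +
          ∫ u in s..(1 / 2), quantile F u ^ 2)| ≤ K := by
  have hEint : IntervalIntegrable
      (fun u : ℝ => D * u ^ (-(1 / 2) : ℝ) + D * (1 - u) ^ (-a)) volume 0 1 := by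
    refine ((intervalIntegral.intervalIntegrable_rpow' (by norm_num)).const_mul D).add
      (IntervalIntegrable.const_mul ?_ D)
    have h := (intervalIntegral.intervalIntegrable_rpow' (r := -a) (a := 1) (b := 0)
      (by linarith)).comp_sub_left 1
    simpa using h
  set E : ℝ → ℝ := fun u => D * u ^ (-(1 / 2) : ℝ) + D * (1 - u) ^ (-a)
  have hE0 : ∀ u ∈ Ioc (0 : ℝ) 1, 0 ≤ E u := fun u hu =>
    add_nonneg (mul_nonneg hD.le (Real.rpow_nonneg hu.1.le _))
      (mul_nonneg hD.le (Real.rpow_nonneg (sub_nonneg.2 hu.2) _))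
  have hself : ∀ b x : ℝ, b ≤ 1 → 0 < x → x ≤ 1 → x * x ^ (-b) ≤ 1 := by
    intro b x hb hx hx1
    nth_rewrite 1 [← Real.rpow_one x]
    rw [← Real.rpow_add hx]
    exact Real.rpow_le_one hx.le hx1 (by linarith)
  have hfar : ∀ b x : ℝ, b ≤ 1 → 0 < x → x < 1 / 2 → (1 - x) ^ (-b) ≤ 2 := by
    intro b x hb hx hx1
    have h1 := hself b (1 - x) hb (by linarith) (by linarith)
    have h2 : 0 ≤ (1 - x) ^ (-b) := Real.rpow_nonneg (by linarith) _
    nlinarith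
  set K₁ := ∫ u in (0 : ℝ)..1, E u
  set L := 3 * D + |quantile F (1 / 2)| with hL
  have hL0 : 0 ≤ L := by positivity
  refine ⟨L ^ 2 + (L + K₁ + 3 * D) ^ 2, fun s t hs hs2 ht ht2 => ?_⟩
  have hst : s < 1 - t := by linarith
  obtain ⟨q, hq1, hq2, hsig⟩ := hF.exists_sigmaSq_eq hs ht hst
  have hsin : s ∈ Ioo (0 : ℝ) 1 := ⟨hs, by linarith⟩
  have hsubset : ∀ x ∈ Icc s (1 - t), x ∈ Ioo (0 : ℝ) 1 := fun x hx =>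
    ⟨hs.trans_le hx.1, hx.2.trans_lt (by linarith)⟩
  have hmono : ∀ x y, s ≤ x → x ≤ y → y ≤ 1 - t → MonotoneOn (quantile F) (uIcc x y) := by
    intro x y hx hxy hy
    rw [uIcc_of_le hxy]
    exact hF.quantile_monotoneOn.mono fun z hz => hsubset z ⟨hx.trans hz.1, hz.2.trans hy⟩
  have hQint : IntervalIntegrable (quantile F) volume s (1 - t) :=
    (hmono s (1 - t) le_rfl hst.le le_rfl).intervalIntegrable
  have hQ2int : ∀ x y, s ≤ x → x ≤ y → y ≤ 1 - t →
      IntervalIntegrable (fun u => quantile F u ^ 2) volume x y :=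
    fun x y hx hxy hy => (hmono x y hx hxy hy).intervalIntegrable_sq hxy
  have hsplit : ∫ u in s..(1 - t), quantile F u ^ 2 =
      (∫ u in s..(1 / 2), quantile F u ^ 2) + ∫ u in t..(1 / 2), quantile F (1 - u) ^ 2 := by
    rw [intervalIntegral.integral_comp_sub_left (fun u => quantile F u ^ 2) 1,
      show (1 : ℝ) - 1 / 2 = 1 / 2 by norm_num]
    exact (intervalIntegral.integral_add_adjacent_intervals
      (hQ2int s (1 / 2) le_rfl hs2.le (by linarith))
      (hQ2int (1 / 2) (1 - t) hs2.le (by linarith) le_rfl)).symm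
  have hmean : |∫ u in s..(1 - t), quantile F u| ≤ K₁ := by
    calc |∫ u in s..(1 - t), quantile F u| ≤ ∫ u in s..(1 - t), |quantile F u| :=
          intervalIntegral.abs_integral_le_integral_abs hst.le
      _ ≤ ∫ u in s..(1 - t), E u := by
          refine intervalIntegral.integral_mono_on hst.le hQint.abs (hEint.mono_set ?_)
            fun u hu => hQ u (hsubset u hu)
          rw [uIcc_of_le hst.le, uIcc_of_le zero_le_one]
          exact Icc_subset_Icc hs.le (by linarith)
      _ ≤ K₁ := by
          refine intervalIntegral.integral_mono_interval hs.le hst.le (by linarith) ?_ hEint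
          filter_upwards [ae_restrict_mem measurableSet_Ioc] with u hu using hE0 u hu
  set y := s ^ (1 / 2 : ℝ) with hy
  have hy0 : 0 < y := Real.rpow_pos_of_pos hs _
  have hy1 : y ≤ 1 := Real.rpow_le_one hs.le (by linarith) (by norm_num)
  have hyy : y * y = s := by
    rw [hy, ← Real.rpow_add hs]
    norm_num
  have hqabs : y * |q| ≤ L := by
    have h1 := hQ s hsin
    have h2 := hfar a s ha1.le hs hs2
    have h3 : y * s ^ (-(1 / 2) : ℝ) = 1 := by
      rw [hy, ← Real.rpow_add hs]
      norm_num
    have h4 := hq2 (1 / 2) ⟨hs2, by linarith⟩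
    have h5 : |q| ≤ D * s ^ (-(1 / 2) : ℝ) + 2 * D + |quantile F (1 / 2)| := by
      have h6 : |quantile F s| ≤ D * s ^ (-(1 / 2) : ℝ) + 2 * D := by nlinarith
      rw [abs_le]
      constructor
      · linarith [neg_abs_le (quantile F s), abs_nonneg (quantile F (1 / 2))]
      · linarith [le_abs_self (quantile F (1 / 2)), abs_nonneg (quantile F s)]
    calc y * |q| ≤ y * (D * s ^ (-(1 / 2) : ℝ) + 2 * D + |quantile F (1 / 2)|) := by gcongr
      _ = D * (y * s ^ (-(1 / 2) : ℝ)) + y * (2 * D + |quantile F (1 / 2)|) := by ring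
      _ ≤ D * 1 + 1 * (2 * D + |quantile F (1 / 2)|) := by
          rw [h3]
          gcongr
      _ = L := by rw [hL]; ring
  have hsq : s * q ^ 2 ≤ L ^ 2 := by
    calc s * q ^ 2 = (y * |q|) ^ 2 := by rw [mul_pow, sq_abs, ← hyy]; ring
      _ ≤ L ^ 2 := pow_le_pow_left₀ (by positivity) hqabs 2
  have hsq1 : |s * q| ≤ L := by
    rw [abs_mul, abs_of_pos hs, ← hyy, mul_assoc]
    exact (mul_le_of_le_one_left (by positivity) hy1).trans hqabs
  have htq : |t * quantile F (1 - t)| ≤ 3 * D := by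
    have h1 := hQ (1 - t) ⟨by linarith, by linarith⟩
    have h2 := hfar (1 / 2) t (by norm_num) ht ht2
    have h3 := hself a t ha1.le ht (by linarith)
    rw [sub_sub_cancel] at h1
    rw [abs_mul, abs_of_pos ht]
    calc t * |quantile F (1 - t)|
        ≤ t * (D * (1 - t) ^ (-(1 / 2) : ℝ) + D * t ^ (-a)) := by gcongr
      _ = t * (D * (1 - t) ^ (-(1 / 2) : ℝ)) + D * (t * t ^ (-a)) := by ring
      _ ≤ 1 * (D * 2) + D * 1 := by
          refine add_le_add (mul_le_mul (by linarith) (mul_le_mul_of_nonneg_left h2 hD.le)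
            (mul_nonneg hD.le (Real.rpow_nonneg (by linarith) _)) zero_le_one)
            (mul_le_mul_of_nonneg_left h3 hD.le)
      _ = 3 * D := by ring
  rw [hsig, hsplit]
  set m := s * q + (∫ u in s..(1 - t), quantile F u) + t * quantile F (1 - t)
  have hmabs : |m| ≤ L + K₁ + 3 * D :=
    (abs_add_three _ _ _).trans (add_le_add (add_le_add hsq1 hmean) htq)
  have hm2 : m ^ 2 ≤ (L + K₁ + 3 * D) ^ 2 := by
    rw [← sq_abs m]
    exact pow_le_pow_left₀ (abs_nonneg _) hmabs 2
  have hsq0 : 0 ≤ s * q ^ 2 := by positivity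
  rw [abs_le]
  constructor <;> linarith [sq_nonneg m, sq_nonneg L, sq_nonneg (L + K₁ + 3 * D)]

/-- under the second-order tail conditions with `α_R < 2` and `α_L = 2`,
there is a strictly positive finite constant `C_R`, depending only on `c_R` and `α_R`,
such that `σ²(m/n, k/n) / (C_R (k/n)^(1 - 2/α_R) + ∫_{m/n}^{1/2} [F⁻(s)]² ds) → 1`
as `n → ∞`. -/
theorem sigmaSq_ratio_tendsto_of_lt_two_eq_two
    (cR αR : ℝ) (hcR : 0 < cR) (hαR1 : 1 < αR) (hαR2 : αR < 2) :
    ∃ CR : ℝ, 0 < CR ∧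
      ∀ (F : ℝ → ℝ) (cL bR bL αL βR βL : ℝ) (m k : ℕ → ℕ),
        IsDistributionFunction F →
        0 < cL → bR ≠ 0 → bL ≠ 0 → 0 < βR → 0 < βL → 1 < αL →
        RightTailSecondOrder F cR αR bR βR →
        LeftTailSecondOrder F cL αL bL βL →
        αL = 2 →
        Tendsto m atTop atTop →
        Tendsto (fun n : ℕ => (m n : ℝ) / n) atTop (nhds 0) →
        Tendsto k atTop atTop →
        Tendsto (fun n : ℕ => (k n : ℝ) / n) atTop (nhds 0) →
        Tendsto
          (fun n : ℕ =>
            sigmaSq F ((m n : ℝ) / n) ((k n : ℝ) / n) /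
              (CR * ((k n : ℝ) / n) ^ (1 - 2 / αR) +
                ∫ s in ((m n : ℝ) / n)..(1 / 2 : ℝ), (quantile F s) ^ 2))
          atTop (nhds 1) := by
  have hα0 : 0 < αR := by linarith
  set a : ℝ := 1 / αR with ha
  have ha0 : 0 < a := by positivity
  have ha1 : a < 1 := (div_lt_one hα0).2 hαR1
  have ha2 : 1 < 2 * a := by
    rw [ha, mul_one_div, lt_div_iff₀ hα0]
    linarith
  set A : ℝ := cR ^ a
  have hA0 : 0 < A := Real.rpow_pos_of_pos hcR _
  have hCR : 0 < A ^ 2 + A ^ 2 / (2 * a - 1) :=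
    add_pos (by positivity) (div_pos (by positivity) (by linarith))
  refine ⟨A ^ 2 + A ^ 2 / (2 * a - 1), hCR, ?_⟩
  intro F cL bR bL αL βR βL m k hF hcL _ _ hβR hβL _ hR hL hαL hm hmn hk hkn
  subst hαL
  set CR : ℝ := A ^ 2 + A ^ 2 / (2 * a - 1)
  have hL1 : Tendsto (fun x : ℝ => F (-x) * x ^ (2 : ℝ)) atTop (𝓝 cL) :=
    tendsto_mul_rpow_of_secondOrder (G := fun x => F (-x)) hcL hβL hL
  have hR1 : Tendsto (fun x : ℝ => (1 - F x) * x ^ αR) atTop (𝓝 cR) :=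
    tendsto_mul_rpow_of_secondOrder (G := fun x => 1 - F x) hcR hβR hR
  obtain ⟨D, hD, hQ⟩ := hF.exists_abs_quantile_le two_pos hα0 hL1 hR1
  obtain ⟨K, hK⟩ := hF.exists_abs_sigmaSq_sub_le hD ha0 ha1 hQ
  have hlimQ := hF.tendsto_quantile_one_sub_mul_rpow hcR hα0 hR1
  have hanti : AntitoneOn (fun u => quantile F (1 - u)) (Ioo 0 1) := by
    intro u hu v hv huv
    exact hF.quantile_monotoneOn ⟨by linarith [hv.2], by linarith [hv.1]⟩
      ⟨by linarith [hu.2], by linarith [hu.1]⟩ (by linarith)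
  have hbound : ∀ u : ℝ, 0 < u → u ≤ 1 / 2 → |quantile F (1 - u)| ≤ 3 * D * u ^ (-a) := by
    intro u hu hu2
    have h1 := hQ (1 - u) ⟨by linarith, by linarith⟩
    rw [sub_sub_cancel] at h1
    have h2 : (1 - u) ^ (-(1 / 2) : ℝ) ≤ 2 := by
      have h3 : (1 - u) ^ (-(1 / 2) : ℝ) ≤ (1 / 2 : ℝ) ^ (-(1 / 2) : ℝ) :=
        Real.rpow_le_rpow_of_nonpos (by norm_num) (by linarith) (by norm_num)
      have h4 : (1 / 2 : ℝ) ^ (-(1 / 2) : ℝ) ≤ (1 / 2 : ℝ) ^ (-1 : ℝ) :=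
        Real.rpow_le_rpow_of_exponent_ge (by norm_num) (by norm_num) (by norm_num)
      rw [Real.rpow_neg_one] at h4
      norm_num at h3 h4 ⊢
      linarith
    have h5 : 1 ≤ u ^ (-a) :=
      Real.one_le_rpow_of_pos_of_le_one_of_nonpos hu (by linarith) (by linarith)
    nlinarith
  have hkar := tendsto_rpow_mul_integral_sq ha2 hanti hlimQ hbound
  set s : ℕ → ℝ := fun n => (m n : ℝ) / n
  set t : ℕ → ℝ := fun n => (k n : ℝ) / n
  have hpos : ∀ {l : ℕ → ℕ}, Tendsto l atTop atTop → ∀ᶠ n in atTop, 0 < (l n : ℝ) / n := by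
    intro l hl
    filter_upwards [hl.eventually_gt_atTop 0, eventually_gt_atTop 0] with n h1 h2
    positivity
  have ht0 : Tendsto t atTop (𝓝[>] 0) := tendsto_nhdsWithin_iff.2 ⟨hkn, hpos hk⟩
  have hs2 : ∀ᶠ n in atTop, s n < 1 / 2 := hmn.eventually_lt_const (by norm_num)
  have ht2 : ∀ᶠ n in atTop, t n < 1 / 2 := hkn.eventually_lt_const (by norm_num)
  have hvanish : Tendsto (fun x : ℝ => x ^ (2 * a - 1)) (𝓝[>] 0) (𝓝 0) := by
    have h := (Real.continuousAt_rpow_const 0 (2 * a - 1) (Or.inr (by linarith))).tendsto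
    rw [Real.zero_rpow (by linarith)] at h
    exact h.mono_left nhdsWithin_le_nhds
  set R : ℝ → ℝ := fun x => x * quantile F (1 - x) ^ 2 +
    ∫ u in x..(1 / 2), quantile F (1 - u) ^ 2 with hRdef
  have hRlim : Tendsto (fun x : ℝ => x ^ (2 * a - 1) * R x) (𝓝[>] 0) (𝓝 CR) := by
    refine ((hlimQ.pow 2).add hkar).congr' ?_
    filter_upwards [self_mem_nhdsWithin] with x hx
    have hx0 : 0 < x := hx
    have e : x ^ (2 * a - 1) * x = (x ^ (1 / αR)) ^ 2 := by
      rw [Real.rpow_sub hx0, Real.rpow_one, div_mul_cancel₀ _ hx0.ne', ← ha, ← Real.rpow_natCast,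
        ← Real.rpow_mul hx0.le]
      congr 1
      push_cast
      ring
    simp only [hRdef]
    rw [mul_pow, ← e]
    ring
  have hmajor : Tendsto (fun n => (|t n ^ (2 * a - 1) * R (t n) - CR| +
      t n ^ (2 * a - 1) * K) / CR) atTop (𝓝 0) := by
    have h1 := ((hRlim.comp ht0).sub_const CR).abs
    have h2 := (hvanish.comp ht0).mul_const K
    have h3 := (h1.add h2).div_const CR
    simpa using h3
  rw [tendsto_iff_norm_sub_tendsto_zero]
  refine squeeze_zero' (Eventually.of_forall fun n => norm_nonneg _) ?_ hmajor
  filter_upwards [hpos hm, hpos hk, hs2, ht2] with n hsn htn hsn2 htn2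
  have hKn := hK (s n) (t n) hsn hsn2 htn htn2
  change 0 < s n at hsn
  change 0 < t n at htn
  change ‖sigmaSq F (s n) (t n) / (CR * t n ^ (1 - 2 / αR) +
    ∫ u in (s n)..(1 / 2 : ℝ), quantile F u ^ 2) - 1‖ ≤ _
  have hexp : 1 - 2 / αR = -(2 * a - 1) := by
    rw [ha]
    ring
  rw [hexp, Real.rpow_neg htn.le]
  have hτ : 0 < t n ^ (2 * a - 1) := Real.rpow_pos_of_pos htn _
  set τ := t n ^ (2 * a - 1)
  set I := ∫ u in (s n)..(1 / 2 : ℝ), quantile F u ^ 2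
  have hI0 : 0 ≤ I := intervalIntegral.integral_nonneg hsn2.le fun u _ => sq_nonneg _
  have hden : 0 < CR * τ⁻¹ + I := by positivity
  have hdenle : CR * τ⁻¹ ≤ CR * τ⁻¹ + I := by linarith
  rw [div_sub_one hden.ne', Real.norm_eq_abs, abs_div, abs_of_pos hden]
  have hnum : |sigmaSq F (s n) (t n) - (CR * τ⁻¹ + I)| ≤
      (|τ * R (t n) - CR| + τ * K) * τ⁻¹ := by
    have e1 : sigmaSq F (s n) (t n) - (CR * τ⁻¹ + I) =
        (sigmaSq F (s n) (t n) - (R (t n) + I)) + (τ * R (t n) - CR) * τ⁻¹ := by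
      field_simp
      ring
    have e2 : (|τ * R (t n) - CR| + τ * K) * τ⁻¹ = K + |τ * R (t n) - CR| * τ⁻¹ := by
      field_simp
      ring
    rw [e1, e2]
    refine (abs_add_le _ _).trans (add_le_add hKn ?_)
    rw [abs_mul, abs_of_pos (inv_pos.2 hτ)]
  calc |sigmaSq F (s n) (t n) - (CR * τ⁻¹ + I)| / (CR * τ⁻¹ + I)
      ≤ ((|τ * R (t n) - CR| + τ * K) * τ⁻¹) / (CR * τ⁻¹) :=
        div_le_div₀ ((abs_nonneg _).trans hnum) hnum (by positivity) hdenle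
    _ = (|τ * R (t n) - CR| + τ * K) / CR := by
        field_simp
end

section
/- Suppose F satisfies the second-order tail conditions with α_R < 2 and α_L = 2, and suppose in addition that B₀ n^{l₀} ≤ m ≤ B₁ n^{l₁} and B₀ n^{l₀} ≤ k ≤ B₁ n^{l₁} for some constants B₀ > 0, B₁ > 0 and 0 < l₀ ≤ l₁ < 1. Then ∫_{m/n}^{1/2} [F⁻(s)]² ds / (k/n)^{1−2/α_R} → 0 as n → ∞. -/
open Filter Set Topology MeasureTheory

/-- A second-order left tail condition gives the first-order bound `F (-x) ≤ 2 c x ^ (-α)`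
for all large `x`. -/
theorem LeftTailSecondOrder.eventually_le {F : ℝ → ℝ} {c α b β : ℝ}
    (h : LeftTailSecondOrder F c α b β) (hc : 0 < c) (hβ : 0 < β) :
    ∀ᶠ x : ℝ in atTop, F (-x) ≤ 2 * c * x ^ (-α) := by
  have h0 := h.mul (tendsto_rpow_neg_atTop hβ)
  rw [mul_zero] at h0
  filter_upwards [h0.eventually (gt_mem_nhds one_pos), eventually_gt_atTop 0] with x hx hx0
  have hcx : 0 < c * x ^ (-α) := mul_pos hc (Real.rpow_pos_of_pos hx0 _)
  rw [mul_assoc, ← Real.rpow_add hx0, add_neg_cancel, Real.rpow_zero, mul_one, sub_lt_iff_lt_add,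
    div_lt_iff₀ hcx] at hx
  linarith

/-- If the left tail of `F` is of order `x ^ (-2)`, the squared quantile function is
at most of order `1 / s` on `(0, 1 / 2]`. -/
theorem IsDistributionFunction.exists_quantile_sq_le {F : ℝ → ℝ} (hF : IsDistributionFunction F)
    {M : ℝ} (hM : 0 ≤ M) (h : ∀ᶠ x : ℝ in atTop, F (-x) ≤ M * x ^ (-2 : ℝ)) :
    ∃ K : ℝ, 0 ≤ K ∧ ∀ s : ℝ, 0 < s → s ≤ 1 / 2 → quantile F s ^ 2 ≤ K * s⁻¹ := by
  obtain ⟨y, hy⟩ := eventually_atTop.1 h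
  obtain ⟨a, ha⟩ := (hF.tendsto_atTop.eventually (lt_mem_nhds one_half_lt_one)).exists
  set A : ℝ := max |a| (max y 1) with hA
  have hAa : |a| ≤ A := le_max_left _ _
  have hAy : y ≤ A := (le_max_left _ _).trans (le_max_right _ _)
  have hA1 : 1 ≤ A := (le_max_right _ _).trans (le_max_right _ _)
  refine ⟨2 * A ^ 2 + 2 * M, by positivity, fun s hs hs2 => ?_⟩
  have hlow : ∀ x ∈ {x : ℝ | s ≤ F x}, -(A + √(M / s)) ≤ x := by
    intro x hx
    by_contra! hlt
    have hr : 0 ≤ √(M / s) := Real.sqrt_nonneg _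
    have hx0 : 0 < -x := by linarith
    have h1 : s ≤ M * (-x) ^ (-2 : ℝ) := by
      have := hy (-x) (by linarith)
      rw [neg_neg] at this
      exact le_trans hx this
    rw [Real.rpow_neg hx0.le, Real.rpow_two, ← div_eq_mul_inv, le_div_iff₀ (by positivity),
      mul_comm, ← le_div_iff₀ hs] at h1
    have := Real.le_sqrt_of_sq_le h1
    linarith
  have hmem : a ∈ {x : ℝ | s ≤ F x} := hs2.trans ha.le
  have h1 : -(A + √(M / s)) ≤ quantile F s := le_csInf ⟨a, hmem⟩ hlow
  have h2 : quantile F s ≤ A + √(M / s) := by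
    have : quantile F s ≤ a := csInf_le ⟨_, hlow⟩ hmem
    linarith [le_abs_self a, Real.sqrt_nonneg (M / s)]
  have h3 : quantile F s ^ 2 ≤ (A + √(M / s)) ^ 2 := sq_le_sq' h1 h2
  have h4 : √(M / s) ^ 2 = M * s⁻¹ := by
    rw [Real.sq_sqrt (by positivity), div_eq_mul_inv]
  have h5 : A ^ 2 ≤ A ^ 2 * s⁻¹ :=
    le_mul_of_one_le_right (by positivity) ((one_le_inv₀ hs).2 (by linarith))
  nlinarith [sq_nonneg (A - √(M / s))]

/-- A function bounded by `K / s` on `(0, 1 / 2]` has integral over `[x, 1 / 2]` at most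
`K log (1 / x)`. -/
theorem abs_integral_half_le_of_abs_le_inv {f : ℝ → ℝ} {K x : ℝ} (hK : 0 ≤ K)
    (hf : ∀ s : ℝ, 0 < s → s ≤ 1 / 2 → |f s| ≤ K * s⁻¹) (hx : 0 < x) (hx2 : x ≤ 1 / 2) :
    |∫ s in x..(1 / 2 : ℝ), f s| ≤ K * Real.log x⁻¹ := by
  have hint : IntervalIntegrable (fun s : ℝ => K * s⁻¹) volume x (1 / 2) :=
    (intervalIntegrable_inv_iff.2
      (Or.inr (notMem_uIcc_of_lt hx (by norm_num)))).const_mul K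
  have h := intervalIntegral.norm_integral_le_of_norm_le (f := f) hx2
    (ae_of_all _ fun s hs => hf s (hx.trans hs.1) hs.2) hint
  rw [intervalIntegral.integral_const_mul, integral_inv_of_pos hx (by norm_num)] at h
  refine h.trans (mul_le_mul_of_nonneg_left (Real.log_le_log (by positivity) ?_) hK)
  rw [div_eq_mul_inv]
  exact mul_le_of_le_one_left (by positivity) (by norm_num)

/-- under the second-order tail conditions with `α_R < 2` and `α_L = 2`,
if in addition `B₀ n^(l₀) ≤ m ≤ B₁ n^(l₁)` and `B₀ n^(l₀) ≤ k ≤ B₁ n^(l₁)` for some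
`B₀ > 0`, `B₁ > 0`, `0 < l₀ ≤ l₁ < 1`, then
`∫_{m/n}^{1/2} [F⁻(s)]² ds / (k/n)^(1 - 2/α_R) → 0` as `n → ∞`. -/
theorem integral_ratio_tendsto_zero_of_lt_two_eq_two
    (F : ℝ → ℝ) (cR cL bR bL αR αL βR βL : ℝ)
    (hF : IsDistributionFunction F)
    (hcR : 0 < cR) (hcL : 0 < cL) (hbR : bR ≠ 0) (hbL : bL ≠ 0)
    (hβR : 0 < βR) (hβL : 0 < βL) (hαR1 : 1 < αR) (hαL1 : 1 < αL)
    (htailR : RightTailSecondOrder F cR αR bR βR)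
    (htailL : LeftTailSecondOrder F cL αL bL βL)
    (hαR : αR < 2) (hαL : αL = 2)
    (m k : ℕ → ℕ)
    (hm_top : Tendsto m atTop atTop)
    (hm_frac : Tendsto (fun n : ℕ => (m n : ℝ) / n) atTop (nhds 0))
    (hk_top : Tendsto k atTop atTop)
    (hk_frac : Tendsto (fun n : ℕ => (k n : ℝ) / n) atTop (nhds 0))
    (B₀ B₁ l₀ l₁ : ℝ) (hB₀ : 0 < B₀) (hB₁ : 0 < B₁)
    (hl₀ : 0 < l₀) (hl₀₁ : l₀ ≤ l₁) (hl₁ : l₁ < 1)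
    (hbound : ∀ n : ℕ,
      B₀ * (n : ℝ) ^ l₀ ≤ (m n : ℝ) ∧ (m n : ℝ) ≤ B₁ * (n : ℝ) ^ l₁ ∧
      B₀ * (n : ℝ) ^ l₀ ≤ (k n : ℝ) ∧ (k n : ℝ) ≤ B₁ * (n : ℝ) ^ l₁) :
    Tendsto
      (fun n : ℕ =>
        (∫ s in ((m n : ℝ) / n)..(1 / 2 : ℝ), (quantile F s) ^ 2) /
          ((k n : ℝ) / n) ^ (1 - 2 / αR))
      atTop (nhds 0) := by
  subst hαL
  obtain ⟨K, hK, hq⟩ := hF.exists_quantile_sq_le (by positivity) (htailL.eventually_le hcL hβL)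
  set γ : ℝ := 2 / αR - 1 with hγdef
  have hγ : 0 < γ := by
    rw [hγdef, sub_pos, one_lt_div (by linarith)]
    exact hαR
  have hp : 0 < (1 - l₁) * γ := mul_pos (by linarith) hγ
  have hlim : Tendsto (fun n : ℕ => K * B₁ ^ γ * (Real.log n / (n : ℝ) ^ ((1 - l₁) * γ)))
      atTop (nhds 0) := by
    simpa using ((isLittleO_log_rpow_atTop hp).tendsto_div_nhds_zero.comp
      tendsto_natCast_atTop_atTop).const_mul (K * B₁ ^ γ)
  refine squeeze_zero_norm' ?_ hlim
  filter_upwards [eventually_gt_atTop 0, hm_top.eventually_ge_atTop 1,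
    hk_top.eventually_ge_atTop 1, hm_frac.eventually (gt_mem_nhds one_half_pos)]
    with n hn hm hk hmn
  have hn0 : (0 : ℝ) < n := Nat.cast_pos.2 hn
  have hm1 : (1 : ℝ) ≤ m n := Nat.one_le_cast.2 hm
  have hk1 : (1 : ℝ) ≤ k n := Nat.one_le_cast.2 hk
  have hkn : 0 < (k n : ℝ) / n := by positivity
  have hI := abs_integral_half_le_of_abs_le_inv hK
    (fun s hs hs2 => (abs_of_nonneg (sq_nonneg _)).trans_le (hq s hs hs2))
    (show 0 < (m n : ℝ) / n by positivity) hmn.le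
  have hlog : Real.log ((m n : ℝ) / n)⁻¹ ≤ Real.log n := by
    refine Real.log_le_log (by positivity) ?_
    rw [inv_div]
    exact div_le_self hn0.le hm1
  have hkγ : ((k n : ℝ) / n) ^ γ ≤ B₁ ^ γ * ((n : ℝ) ^ ((1 - l₁) * γ))⁻¹ := by
    have h1 : (k n : ℝ) / n ≤ B₁ * ((n : ℝ) ^ (1 - l₁))⁻¹ := by
      rw [← Real.rpow_neg hn0.le, neg_sub, Real.rpow_sub hn0, Real.rpow_one, ← mul_div_assoc]
      exact div_le_div_of_nonneg_right (hbound n).2.2.2 hn0.le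
    refine (Real.rpow_le_rpow hkn.le h1 hγ.le).trans_eq ?_
    rw [Real.mul_rpow hB₁.le (by positivity), Real.inv_rpow (by positivity),
      ← Real.rpow_mul hn0.le]
  have hexp : 1 - 2 / αR = -γ := by rw [hγdef]; ring
  rw [hexp, Real.rpow_neg hkn.le, div_inv_eq_mul, norm_mul, Real.norm_eq_abs,
    Real.norm_of_nonneg (Real.rpow_nonneg hkn.le γ)]
  calc _ ≤ K * Real.log n * (B₁ ^ γ * ((n : ℝ) ^ ((1 - l₁) * γ))⁻¹) :=
        mul_le_mul (hI.trans (mul_le_mul_of_nonneg_left hlog hK)) hkγ (by positivity)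
          (mul_nonneg hK (Real.log_natCast_nonneg n))
    _ = _ := by ring
end
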